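/- Theorem (characterization of properness by an implicitization matrix). Given an implicitization-matrix datum for φ, assume in addition (condition (3) of the definition of an implicitization matrix) that if φ is proper then δ = 1. Then φ is proper if and only if the gcd of Δ_{α₁}, …, Δ_{α_d} in K[X₁,X₂,X₃,X₄] is a nonzero constant of K. -/

import Mathlib

open MvPolynomial

/-- The rational function field `K(u,v)`, realized as the fraction field of `K[u,v]`. -/
noncomputable abbrev RatFuncTwo (K : Type*) [Field K] : Type _ :=
  FractionRing (MvPolynomial (Fin 2) K)

/-- The three affine coordinates `φᵢ = pᵢ(u,v,1)/p₄(u,v,1)` (for `i = 1,2,3`) of the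
parameterization `φ` determined by `p = (p₁,p₂,p₃,p₄)`, as elements of `K(u,v)`. -/
noncomputable def phiCoord {K : Type*} [Field K]
    (p : Fin 4 → MvPolynomial (Fin 3) K) (i : Fin 3) : RatFuncTwo K :=
  algebraMap (MvPolynomial (Fin 2) K) (RatFuncTwo K)
      (MvPolynomial.aeval ![MvPolynomial.X 0, MvPolynomial.X 1, 1] (p i.castSucc)) /
    algebraMap (MvPolynomial (Fin 2) K) (RatFuncTwo K)
      (MvPolynomial.aeval ![MvPolynomial.X 0, MvPolynomial.X 1, 1] (p 3))

/-- `φ` is proper (birational onto its image) if the subfield `K(φ₁,φ₂,φ₃)` of `K(u,v)`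
generated over `K` by `φ₁, φ₂, φ₃` is all of `K(u,v)`. -/
noncomputable def IsProperParam {K : Type*} [Field K]
    (p : Fin 4 → MvPolynomial (Fin 3) K) : Prop :=
  IntermediateField.adjoin K {phiCoord p 0, phiCoord p 1, phiCoord p 2} = ⊤

/-- If the row vector `w` is orthogonal to all columns of `A` except possibly the first, then it is
proportional to the row vector of signed maximal minors of those columns. -/
theorem Matrix.mul_adjugate_zero_comm_of_vecMul_succ_eq_zero {R : Type*} [CommRing R] {n : ℕ}
    (A : Matrix (Fin (n + 1)) (Fin (n + 1)) R) (w : Fin (n + 1) → R)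
    (h : ∀ j : Fin n, ∑ i, w i * A i j.succ = 0) (i j : Fin (n + 1)) :
    w i * A.adjugate 0 j = w j * A.adjugate 0 i := by
  have hadj : ∀ (x : Fin (n + 1) → R) k,
      (A.updateCol 0 x).adjugate 0 k = A.adjugate 0 k := by
    intro x k
    simp only [Matrix.adjugate_fin_succ_eq_det_submatrix]
    congr 2
  set B := A.updateCol 0 (Pi.single j 1) with hB
  have hdet : B.det = A.adjugate 0 j := by
    rw [Matrix.det_eq_sum_mul_adjugate_col B 0, Fintype.sum_eq_single j]
    · simp [hB, hadj]
    · intro k hk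
      simp [hB, Pi.single_eq_of_ne hk]
  have hw : Matrix.vecMul w B = Pi.single 0 (w j) := by
    ext k
    refine Fin.cases ?_ (fun k => ?_) k
    · simp [hB, Matrix.vecMul, dotProduct, Pi.single_apply]
    · simpa [hB, Matrix.vecMul, dotProduct, Matrix.updateCol_apply, Fin.succ_ne_zero] using h k
  have key := congrFun (congrArg (fun v => Matrix.vecMul v B.adjugate) hw) i
  simp only [Matrix.vecMul_vecMul, Matrix.mul_adjugate, Matrix.vecMul_smul, Matrix.vecMul_one,
    Matrix.single_vecMul, Pi.smul_apply, smul_eq_mul] at key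
  rw [hdet, Matrix.row_apply, hB, hadj] at key
  rw [← key, mul_comm]

/-- The same proportionality after applying a ring homomorphism to the entries of the matrix. -/
theorem Matrix.mul_map_adjugate_zero_comm {R S : Type*} [CommRing R] [CommRing S] {n : ℕ}
    (f : R →+* S) (A : Matrix (Fin (n + 1)) (Fin (n + 1)) R) (w : Fin (n + 1) → S)
    (h : ∀ j : Fin n, ∑ i, w i * f (A i j.succ) = 0) (i j : Fin (n + 1)) :
    w i * f (A.adjugate 0 j) = w j * f (A.adjugate 0 i) := by
  have hadj : ∀ l, f (A.adjugate 0 l) = (f.mapMatrix A).adjugate 0 l := fun l =>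
    congrFun (congrFun (f.map_adjugate A) 0) l
  rw [hadj, hadj]
  exact mul_adjugate_zero_comm_of_vecMul_succ_eq_zero _ w h i j

namespace MvPolynomial

/-- Evaluating a homogeneous polynomial at a scaled point. -/
theorem aeval_mul_const_of_isHomogeneous {σ R A : Type*} [CommSemiring R] [CommSemiring A]
    [Algebra R A] {P : MvPolynomial σ R} {e : ℕ} (hP : P.IsHomogeneous e) (a : A) (x : σ → A) :
    aeval (fun i => a * x i) P = a ^ e * aeval x P := by
  simp only [aeval_def, eval₂_eq, Finset.mul_sum]
  refine Finset.sum_congr rfl fun s hs => ?_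
  have hdeg : ∑ i ∈ s.support, s i = e := by
    by_contra hne
    exact mem_support_iff.mp hs (hP.coeff_eq_zero hne)
  simp only [mul_pow, Finset.prod_mul_distrib]
  rw [Finset.prod_pow_eq_pow_sum, hdeg]
  ring

/-- A homogeneous polynomial whose dehomogenization vanishes is zero. -/
theorem eq_zero_of_dehomogenize_eq_zero {K : Type*} [Field K]
    {P : MvPolynomial (Fin 3) K} {e : ℕ} (hP : P.IsHomogeneous e)
    (h : aeval ![(X 0 : MvPolynomial (Fin 2) K), X 1, 1] P = 0) : P = 0 := by
  let L := FractionRing (MvPolynomial (Fin 3) K)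
  let T : Fin 3 → L := fun i => algebraMap (MvPolynomial (Fin 3) K) L (X i)
  have hT : T 2 ≠ 0 := by
    simp [T]
  let g : MvPolynomial (Fin 2) K →ₐ[K] L := aeval ![T 0 / T 2, T 1 / T 2]
  have h1 : aeval ![T 0 / T 2, T 1 / T 2, 1] P = 0 := by
    have h2 : (g.comp (aeval ![(X 0 : MvPolynomial (Fin 2) K), X 1, 1])) P = 0 := by
      rw [AlgHom.comp_apply, h, map_zero]
    rw [comp_aeval] at h2
    rw [← h2]
    congr 2
    ext i
    fin_cases i <;> simp [g]
  have h3 : aeval T P = 0 := by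
    have h4 := aeval_mul_const_of_isHomogeneous hP (T 2) ![T 0 / T 2, T 1 / T 2, 1]
    rw [h1, mul_zero] at h4
    rw [← h4]
    congr 2
    ext i
    fin_cases i <;> simp [mul_div_cancel₀, hT]
  apply IsFractionRing.injective (MvPolynomial (Fin 3) K) L
  rw [map_zero, ← h3]
  conv_lhs => rw [← aeval_X_left_apply P]
  exact (aeval_algebraMap_apply L X P).symm

/-- The determinant of a matrix whose columns are homogeneous is homogeneous. -/
theorem isHomogeneous_det {σ ι R : Type*} [CommRing R] [Fintype ι] [DecidableEq ι]
    {A : Matrix ι ι (MvPolynomial σ R)} {e : ι → ℕ} (h : ∀ i j, (A i j).IsHomogeneous (e j)) :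
    A.det.IsHomogeneous (∑ j, e j) := by
  rw [Matrix.det_apply]
  refine IsHomogeneous.sum _ _ _ fun s _ => ?_
  have := IsHomogeneous.prod Finset.univ (fun j => A (s j) j) e fun j _ => h _ _
  rcases Int.units_eq_one_or (Equiv.Perm.sign s) with hs | hs
  · simpa [hs] using this
  · simpa [hs] using this.neg

end MvPolynomial

/-- Polynomial expressions in elements of an intermediate field stay in it. -/
theorem IntermediateField.aeval_mem {σ K L : Type*} [Field K] [Field L] [Algebra K L]
    (E : IntermediateField K L) {x : σ → L} (hx : ∀ i, x i ∈ E) (P : MvPolynomial σ K) :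
    aeval x P ∈ E := by
  induction P using MvPolynomial.induction_on with
  | C a => simp
  | add P Q hP hQ => simpa using E.add_mem hP hQ
  | mul_X P i hP => simpa using E.mul_mem hP (hx i)

/-- A subfield of `K(u,v)` containing `K`, `u` and `v` is everything. -/
theorem RatFuncTwo.eq_top_of_X_mem {K : Type*} [Field K] (E : IntermediateField K (RatFuncTwo K))
    (h : ∀ i, algebraMap (MvPolynomial (Fin 2) K) (RatFuncTwo K) (X i) ∈ E) : E = ⊤ := by
  have hpoly : ∀ P : MvPolynomial (Fin 2) K,
      algebraMap (MvPolynomial (Fin 2) K) (RatFuncTwo K) P ∈ E := by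
    intro P
    have hP := aeval_algebraMap_apply (RatFuncTwo K) (X : Fin 2 → MvPolynomial (Fin 2) K) P
    rw [aeval_X_left_apply] at hP
    exact hP ▸ E.aeval_mem h P
  rw [eq_top_iff]
  intro x _
  obtain ⟨a, b, _, rfl⟩ := IsFractionRing.div_surjective (A := MvPolynomial (Fin 2) K) x
  exact E.div_mem (hpoly a) (hpoly b)

/-- If `tᵢ / t₃` is a quotient of two forms of equal degree in the `pⱼ` for `i = 1, 2`,
then the parameterization is proper. -/
theorem isProperParam_of_inverse {K : Type*} [Field K] {p : Fin 4 → MvPolynomial (Fin 3) K}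
    {N : ℕ} (hphom : ∀ i, (p i).IsHomogeneous N) (hp4 : p 3 ≠ 0) {e : ℕ}
    (A : Fin 2 → MvPolynomial (Fin 4) K) (B : MvPolynomial (Fin 4) K)
    (hA : ∀ i, (A i).IsHomogeneous e) (hB : B.IsHomogeneous e) (hB0 : aeval p B ≠ 0)
    (h : ∀ i : Fin 2, X i.castSucc * aeval p B = X 2 * aeval p (A i)) :
    IsProperParam p := by
  let dehom : MvPolynomial (Fin 3) K →ₐ[K] MvPolynomial (Fin 2) K := aeval ![X 0, X 1, 1]
  let ψ : MvPolynomial (Fin 3) K →ₐ[K] RatFuncTwo K :=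
    (IsScalarTower.toAlgHom K (MvPolynomial (Fin 2) K) (RatFuncTwo K)).comp dehom
  have hψ : ∀ P, ψ P = algebraMap _ (RatFuncTwo K) (dehom P) := fun P => rfl
  have hψ0 : ∀ {P : MvPolynomial (Fin 3) K} {k : ℕ}, P.IsHomogeneous k → P ≠ 0 → ψ P ≠ 0 := by
    intro P k hP hP0 hz
    rw [hψ, IsFractionRing.to_map_eq_zero_iff] at hz
    exact hP0 (eq_zero_of_dehomogenize_eq_zero hP hz)
  have hd : ψ (p 3) ≠ 0 := hψ0 (hphom 3) hp4
  let q : Fin 4 → RatFuncTwo K := fun i => ψ (p i) / ψ (p 3)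
  have heval : ∀ {G : MvPolynomial (Fin 4) K}, G.IsHomogeneous e →
      ψ (aeval p G) = ψ (p 3) ^ e * aeval q G := by
    intro G hG
    rw [← aeval_mul_const_of_isHomogeneous hG, ← AlgHom.comp_apply, comp_aeval]
    congr 2
    ext i
    exact (mul_div_cancel₀ _ hd).symm
  set E := IntermediateField.adjoin K {phiCoord p 0, phiCoord p 1, phiCoord p 2} with hE
  have hq : ∀ i, q i ∈ E := by
    intro i
    refine Fin.lastCases ?_ (fun i => ?_) i
    · have : q (Fin.last 3) = 1 := div_self hd
      rw [this]
      exact E.one_mem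
    · apply IntermediateField.subset_adjoin
      change phiCoord p i ∈ _
      fin_cases i <;> simp
  have hB1 : ψ (aeval p B) ≠ 0 := hψ0 (hB.aeval p hphom) hB0
  have hBq : aeval q B ≠ 0 := by
    intro hz
    rw [heval hB, hz, mul_zero] at hB1
    exact hB1 rfl
  apply RatFuncTwo.eq_top_of_X_mem
  intro i
  have hi := congrArg ψ (h i)
  rw [map_mul, map_mul, heval hB, heval (hA i)] at hi
  have h2 : ψ (X 2) = 1 := by simp [hψ, dehom]
  have h1 : ψ (X i.castSucc) = algebraMap (MvPolynomial (Fin 2) K) (RatFuncTwo K) (X i) := by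
    fin_cases i <;> simp [hψ, dehom]
  rw [h1, h2, one_mul, mul_left_comm] at hi
  have hi' := mul_left_cancel₀ (pow_ne_zero e hd) hi
  rw [← eq_div_iff hBq] at hi'
  rw [hi']
  exact E.div_mem (E.aeval_mem hq (A i)) (E.aeval_mem hq B)

/-- characterization of properness by an implicitization matrix.
Given an implicitization-matrix datum for `φ`, assume moreover (condition (3) of the
definition of an implicitization matrix) that if `φ` is proper then `δ = 1`.  Then `φ`
is proper if and only if the gcd of the signed maximal minors `Δ_{α₁}, …, Δ_{α_d}` of
`M*` is a nonzero constant of `K`. -/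
theorem proper_iff_gcd_of_minors_isUnit
    (K : Type*) [Field K] [CharZero K]
    (p : Fin 4 → MvPolynomial (Fin 3) K)
    (N : ℕ) (hN : 1 ≤ N) (hphom : ∀ i, (p i).IsHomogeneous N) (hp4 : p 3 ≠ 0)
    (F : MvPolynomial (Fin 4) K)
    (hFhom : ∃ D : ℕ, F.IsHomogeneous D) (hFirr : Irreducible F)
    (hFimp : ∀ G : MvPolynomial (Fin 4) K, aeval p G = 0 ↔ F ∣ G)
    (n : ℕ) (hn : 2 ≤ n) (m : ℕ) (hm : 1 ≤ m)
    (α : Fin (n + 1) → (Fin 3 →₀ ℕ)) (hαinj : Function.Injective α)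
    (hαdeg : ∀ i, (α i).sum (fun _ e => e) = m)
    (b : Fin 3 → Fin (n + 1))
    (hb1 : (X 0 : MvPolynomial (Fin 3) K) * monomial (α (b 2)) 1 =
      (X 2 : MvPolynomial (Fin 3) K) * monomial (α (b 0)) 1)
    (hb2 : (X 1 : MvPolynomial (Fin 3) K) * monomial (α (b 2)) 1 =
      (X 2 : MvPolynomial (Fin 3) K) * monomial (α (b 1)) 1)
    (M : Matrix (Fin (n + 1)) (Fin (n + 1)) (MvPolynomial (Fin 4) K))
    (hcol0 : ∃ e : ℕ, 1 ≤ e ∧ ∀ i, (M i 0).IsHomogeneous e)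
    (hcolhom : ∀ j : Fin n, ∃ dj : ℕ, 1 ≤ dj ∧ ∀ i, (M i j.succ).IsHomogeneous dj)
    (hcolmoving : ∀ j : Fin n,
      ∑ i : Fin (n + 1), (monomial (α i) (1 : K)) * (aeval p) (M i j.succ) = 0)
    (c : K) (hc : c ≠ 0) (δ : ℕ) (hδ : 1 ≤ δ)
    (hMdet : M.det = C c * F ^ δ)
    (Mstar : Matrix (Fin (n + 1)) (Fin n) (MvPolynomial (Fin 4) K))
    (hMstar : ∀ i j, Mstar i j = M i j.succ)
    (Δ : Fin (n + 1) → MvPolynomial (Fin 4) K)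
    (hΔ : ∀ i : Fin (n + 1),
      Δ i = (-1 : MvPolynomial (Fin 4) K) ^ (i : ℕ) *
        (Mstar.submatrix i.succAbove id).det)
    (hδ1 : IsProperParam p → δ = 1) :
    IsProperParam p ↔
      ∃ u : K, u ≠ 0 ∧ (∀ i, (C u : MvPolynomial (Fin 4) K) ∣ Δ i) ∧
        (∀ g : MvPolynomial (Fin 4) K, (∀ i, g ∣ Δ i) → g ∣ C u) := by
  have hΔadj : ∀ i, Δ i = M.adjugate 0 i := by
    intro i
    rw [hΔ, Matrix.adjugate_fin_succ_eq_det_submatrix]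
    congr 2
    ext a j
    simp [hMstar]
  have hdet : M.det = ∑ i, M i 0 * Δ i := by
    simp only [hΔadj]
    exact Matrix.det_eq_sum_mul_adjugate_col M 0
  have hCc : IsUnit (C c : MvPolynomial (Fin 4) K) := (isUnit_iff_ne_zero.mpr hc).map C
  constructor
  · intro hproper
    rw [hδ1 hproper, pow_one] at hMdet
    refine ⟨1, one_ne_zero, fun i => by simp, fun g hg => ?_⟩
    have hgdet : g ∣ M.det := hdet ▸ Finset.dvd_sum fun i _ => (hg i).mul_left _
    rw [hMdet, hCc.dvd_mul_left] at hgdet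
    by_contra hgu
    rw [map_one, ← isUnit_iff_dvd_one] at hgu
    have hFg : F ∣ g := ((hFirr.dvd_iff.mp hgdet).resolve_left hgu).dvd
    choose Q hQ using fun i => hFg.trans (hg i)
    have hsum : ∑ i, M i 0 * Q i = C c := by
      apply mul_left_cancel₀ hFirr.ne_zero
      rw [mul_comm F (C c), ← hMdet, hdet, Finset.mul_sum]
      refine Finset.sum_congr rfl fun i _ => ?_
      rw [hQ]
      ring
    obtain ⟨e, he, hM0⟩ := hcol0
    have hconst := congrArg constantCoeff hsum
    have hM00 : ∀ i, constantCoeff (M i 0) = 0 := fun i =>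
      (hM0 i).coeff_eq_zero (by simp; omega)
    simp only [map_sum, map_mul, hM00, zero_mul, Finset.sum_const_zero, constantCoeff_C] at hconst
    exact hc hconst.symm
  · rintro ⟨u, hu, -, hgcd⟩
    have hCu : IsUnit (C u : MvPolynomial (Fin 4) K) := (isUnit_iff_ne_zero.mpr hu).map C
    obtain ⟨k, hk⟩ : ∃ k, aeval p (Δ k) ≠ 0 := by
      by_contra! hall
      exact hFirr.not_isUnit
        (isUnit_of_dvd_unit (hgcd F fun i => (hFimp _).mp (hall i)) hCu)
    have hprop : ∀ i j, (monomial (α i) (1 : K)) * aeval p (Δ j) =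
        monomial (α j) 1 * aeval p (Δ i) := by
      intro i j
      rw [hΔadj, hΔadj]
      exact Matrix.mul_map_adjugate_zero_comm (aeval p).toRingHom M
        (fun i => monomial (α i) (1 : K)) hcolmoving i j
    have hmon : ∀ i, (monomial (α i) (1 : K)) ≠ 0 := by
      intro i
      simp
    have hb0 : aeval p (Δ (b 2)) ≠ 0 := by
      intro hz
      have := hprop (b 2) k
      rw [hz, mul_zero] at this
      exact mul_ne_zero (hmon _) hk this
    choose e he using hcolhom
    have hΔhom : ∀ i, (Δ i).IsHomogeneous (∑ j, e j) := by
      intro i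
      rw [hΔ]
      have hminor : (Mstar.submatrix i.succAbove id).det.IsHomogeneous (∑ j, e j) :=
        isHomogeneous_det fun a j => by simpa [hMstar] using (he j).2 _
      rcases neg_one_pow_eq_or (MvPolynomial (Fin 4) K) (i : ℕ) with hs | hs
      · simpa [hs] using hminor
      · simpa [hs] using hminor.neg
    refine isProperParam_of_inverse hphom hp4 ![Δ (b 0), Δ (b 1)] (Δ (b 2))
      (fun i => ?_) (hΔhom _) hb0 fun i => ?_
    · fin_cases i <;> exact hΔhom _
    · have hcancel : ∀ (s : Fin 3) (l : Fin (n + 1)),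
          (X s : MvPolynomial (Fin 3) K) * monomial (α (b 2)) 1 = X 2 * monomial (α l) 1 →
          X s * aeval p (Δ (b 2)) = X 2 * aeval p (Δ l) := by
        intro s l hl
        apply mul_left_cancel₀ (hmon (b 2))
        linear_combination (-(X 2 : MvPolynomial (Fin 3) K)) * hprop (b 2) l +
          aeval p (Δ (b 2)) * hl
      fin_cases i
      · exact hcancel 0 (b 0) hb1
      · exact hcancel 1 (b 1) hb2
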